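/- Let n ≥ 5 and let U be the standard bubble. Let a_{ijkl} (1 ≤ i,j,k,l ≤ n-1) be real constants antisymmetric in the first two indices, i.e. a_{ijkl} = -a_{jikl} for all i,j,k,l, and let b_{ij} (1 ≤ i,j ≤ n-1) be real constants with ∑_{i=1}^{n-1} b_{ii} = 0. Set F(y) := ∑_{i,j=1}^{n-1} [ (1/3)·∑_{k,l=1}^{n-1} a_{ijkl}·y_k·y_l + b_{ij}·yₙ² ]·∂²U/∂y_i∂y_j(y). Then ∫_{ℝⁿ₊} F(y)·U(y) dy = 0 and ∫_{ℝⁿ₊} F(y)·( ∑_{b=1}^{n} y_b·∂U/∂y_b(y) ) dy = 0. -/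

import Mathlib

open MeasureTheory

noncomputable section

/-- The index of the last coordinate in `Fin n`. -/
def lastIdx (n : ℕ) [NeZero n] : Fin n :=
  ⟨n - 1, Nat.sub_lt (Nat.pos_of_ne_zero (NeZero.ne n)) Nat.one_pos⟩

/-- The last coordinate `yₙ` of a point `y ∈ ℝⁿ`. -/
def lastCoord (n : ℕ) [NeZero n] (y : EuclideanSpace ℝ (Fin n)) : ℝ :=
  y (lastIdx n)

/-- `|ȳ|²`, the squared norm of the first `n-1` coordinates. -/
def barNormSq (n : ℕ) [NeZero n] (y : EuclideanSpace ℝ (Fin n)) : ℝ :=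
  ∑ i : Fin n, if (i : ℕ) < n - 1 then (y i) ^ 2 else 0

/-- The standard bubble `U(y) = ((1+yₙ)² + |ȳ|²)^(-(n-2)/2)`. -/
def bubble (n : ℕ) [NeZero n] (y : EuclideanSpace ℝ (Fin n)) : ℝ :=
  ((1 + lastCoord n y) ^ 2 + barNormSq n y) ^ (-((n : ℝ) - 2) / 2)

/-- The partial derivative `∂f/∂yᵢ`. -/
def partialDeriv (n : ℕ) (f : EuclideanSpace ℝ (Fin n) → ℝ) (i : Fin n)
    (y : EuclideanSpace ℝ (Fin n)) : ℝ :=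
  fderiv ℝ f y (EuclideanSpace.single i 1)

/-- The closed upper half-space `ℝⁿ₊ = {y : yₙ ≥ 0}`. -/
def halfSpace (n : ℕ) [NeZero n] : Set (EuclideanSpace ℝ (Fin n)) :=
  {y | 0 ≤ lastCoord n y}

/-- The inclusion of a boundary index `i ∈ {1,…,n-1}` into `Fin n`. -/
def bIdx (n : ℕ) (i : Fin (n - 1)) : Fin n := Fin.castLE (Nat.sub_le n 1) i

lemma sum_signs (m : ℕ) (i j : Fin m) (hij : i ≠ j) :
    ∑ s : Fin m → ℤˣ, (((s i : ℤˣ) : ℤ) : ℝ) * (((s j : ℤˣ) : ℤ) : ℝ) = 0 := by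
  have h := Equiv.sum_comp (Equiv.mulRight (Pi.mulSingle i (-1) : Fin m → ℤˣ))
    (fun s : Fin m → ℤˣ => (((s i : ℤˣ) : ℤ) : ℝ) * (((s j : ℤˣ) : ℤ) : ℝ))
  simp [Pi.mulSingle_eq_of_ne hij.symm] at h
  linarith

/-- sign flip of the boundary coordinates -/
def signIso (m : ℕ) (s : Fin m → ℤˣ) :
    EuclideanSpace ℝ (Fin (m + 1)) ≃ₗᵢ[ℝ] EuclideanSpace ℝ (Fin (m + 1)) :=
  LinearIsometryEquiv.piLpCongrRight 2
    (fun k : Fin (m + 1) =>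
      if ((Fin.snoc s (1 : ℤˣ) : Fin (m + 1) → ℤˣ) k) = 1 then LinearIsometryEquiv.refl ℝ ℝ
      else LinearIsometryEquiv.neg ℝ)

lemma signIso_castSucc (m : ℕ) (s : Fin m → ℤˣ) (y : EuclideanSpace ℝ (Fin (m + 1)))
    (i : Fin m) : signIso m s y i.castSucc = (((s i : ℤˣ) : ℤ) : ℝ) * y i.castSucc := by
  rcases Int.units_eq_one_or (s i) with h | h <;> simp [signIso, h]

lemma signIso_last (m : ℕ) (s : Fin m → ℤˣ) (y : EuclideanSpace ℝ (Fin (m + 1))) :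
    signIso m s y (Fin.last m) = y (Fin.last m) := by
  simp [signIso]

/-- permutation of the boundary coordinates -/
def permIso (m : ℕ) (e : Equiv.Perm (Fin m)) :
    EuclideanSpace ℝ (Fin (m + 1)) ≃ₗᵢ[ℝ] EuclideanSpace ℝ (Fin (m + 1)) :=
  LinearIsometryEquiv.piLpCongrLeft 2 ℝ ℝ
    ((finSuccEquivLast.trans (Equiv.optionCongr e)).trans finSuccEquivLast.symm).symm

lemma permIso_castSucc (m : ℕ) (e : Equiv.Perm (Fin m)) (y : EuclideanSpace ℝ (Fin (m + 1)))
    (i : Fin m) : permIso m e y i.castSucc = y (e i).castSucc := by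
  simp [permIso, LinearIsometryEquiv.piLpCongrLeft_apply, Equiv.piCongrLeft']

lemma permIso_last (m : ℕ) (e : Equiv.Perm (Fin m)) (y : EuclideanSpace ℝ (Fin (m + 1))) :
    permIso m e y (Fin.last m) = y (Fin.last m) := by
  simp [permIso, LinearIsometryEquiv.piLpCongrLeft_apply, Equiv.piCongrLeft']

lemma unit_sq (u : ℤˣ) : ((u : ℤ) : ℝ) * ((u : ℤ) : ℝ) = 1 := by
  rcases Int.units_eq_one_or u with h | h <;> simp [h]

lemma core_zero (m : ℕ) [NeZero m] (b : Fin m → Fin m → ℝ) (hb : ∑ i, b i i = 0)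
    (h : ℝ → ℝ → ℝ) :
    ∫ y in {y : EuclideanSpace ℝ (Fin (m + 1)) | 0 ≤ y (Fin.last m)},
      (∑ i, ∑ j, b i j * (y (Fin.castSucc i) * y (Fin.castSucc j))) *
        h (∑ i : Fin m, y (Fin.castSucc i) ^ 2) (y (Fin.last m)) = 0 := by
  set S := {y : EuclideanSpace ℝ (Fin (m + 1)) | 0 ≤ y (Fin.last m)} with hS
  set G : EuclideanSpace ℝ (Fin (m + 1)) → ℝ := fun y =>
      (∑ i, ∑ j, b i j * (y (Fin.castSucc i) * y (Fin.castSucc j))) *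
        h (∑ i : Fin m, y (Fin.castSucc i) ^ 2) (y (Fin.last m)) with hG
  change ∫ y in S, G y = 0
  by_cases hint : IntegrableOn G S
  swap
  · exact integral_undef hint
  let T : (Fin m → ℤˣ) × Fin m →
      EuclideanSpace ℝ (Fin (m + 1)) ≃ₗᵢ[ℝ] EuclideanSpace ℝ (Fin (m + 1)) :=
    fun p => (permIso m (Equiv.addRight p.2)).trans (signIso m p.1)
  have Tc : ∀ p y (i : Fin m), T p y i.castSucc
      = (((p.1 i : ℤˣ) : ℤ) : ℝ) * y (i + p.2).castSucc := by
    intro p y i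
    simp [T, signIso_castSucc, permIso_castSucc]
  have Tl : ∀ p y, T p y (Fin.last m) = y (Fin.last m) := by
    intro p y
    simp [T, signIso_last, permIso_last]
  have hpre : ∀ p, (T p) ⁻¹' S = S := by
    intro p; ext y; simp [hS, Tl]
  have hmp : ∀ p, MeasurePreserving (T p) volume volume := fun p => (T p).measurePreserving
  have hemb : ∀ p, MeasurableEmbedding (T p) :=
    fun p => (T p).toHomeomorph.measurableEmbedding
  have hI : ∀ p, ∫ y in S, G (T p y) = ∫ y in S, G y := by
    intro p
    have := (hmp p).setIntegral_preimage_emb (hemb p) G S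
    rwa [hpre] at this
  have hInt : ∀ p, IntegrableOn (fun y => G (T p y)) S := by
    intro p
    have := (hmp p).integrableOn_comp_preimage (hemb p) (f := G) (s := S)
    rw [hpre] at this
    exact this.2 hint
  have hsum : ∀ y, ∑ p, G (T p y) = 0 := by
    intro y
    have hr : ∀ p, ∑ i : Fin m, T p y (Fin.castSucc i) ^ 2
        = ∑ i : Fin m, y (Fin.castSucc i) ^ 2 := by
      intro p
      simp only [Tc, mul_pow]
      simp only [sq, unit_sq, one_mul]
      exact Equiv.sum_comp (Equiv.addRight p.2)
        (fun i : Fin m => y (Fin.castSucc i) * y (Fin.castSucc i))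
    simp only [hG, hr, Tl]
    rw [← Finset.sum_mul]
    apply mul_eq_zero_of_left
    rw [Finset.sum_comm]
    have key : ∀ i j : Fin m, ∑ p : (Fin m → ℤˣ) × Fin m,
        b i j * (T p y i.castSucc * T p y j.castSucc)
        = if i = j then b i i * ((Fintype.card (Fin m → ℤˣ) : ℝ) *
            ∑ k : Fin m, y k.castSucc ^ 2) else 0 := by
      intro i j
      rw [← Finset.mul_sum, Fintype.sum_prod_type_right]
      simp only [Tc]
      split_ifs with hij
      · subst hij
        congr 1
        have : ∀ (t : Fin m) (s : Fin m → ℤˣ), (((s i : ℤˣ) : ℤ) : ℝ) * y (i + t).castSucc *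
            ((((s i : ℤˣ) : ℤ) : ℝ) * y (i + t).castSucc) = y (i + t).castSucc ^ 2 := by
          intro t s
          rw [mul_mul_mul_comm, unit_sq, one_mul, sq]
        simp only [this, Finset.sum_const, Finset.card_univ, nsmul_eq_mul]
        rw [← Finset.mul_sum]
        congr 1
        exact Equiv.sum_comp (Equiv.addLeft i) (fun k : Fin m => y k.castSucc ^ 2)
      · apply mul_eq_zero_of_right
        apply Finset.sum_eq_zero
        intro t _
        simp only [mul_mul_mul_comm]
        rw [← Finset.sum_mul, sum_signs m i j hij, zero_mul]
    have : ∀ i : Fin m, ∑ p : (Fin m → ℤˣ) × Fin m, ∑ j : Fin m,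
        b i j * (T p y i.castSucc * T p y j.castSucc)
        = b i i * ((Fintype.card (Fin m → ℤˣ) : ℝ) * ∑ k : Fin m, y k.castSucc ^ 2) := by
      intro i
      rw [Finset.sum_comm]
      simp only [key]
      simp
    rw [Finset.sum_congr rfl (fun i _ => this i), ← Finset.sum_mul, hb, zero_mul]
  have h1 : ∑ p, ∫ y in S, G (T p y) = 0 := by
    rw [← integral_finsetSum _ (fun p _ => hInt p)]
    simp only [hsum, integral_zero]
  simp only [hI, Finset.sum_const, Finset.card_univ, nsmul_eq_mul] at h1
  rcases mul_eq_zero.1 h1 with h2 | h2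
  · have : Fintype.card ((Fin m → ℤˣ) × Fin m) ≠ 0 := Fintype.card_ne_zero
    exact absurd (by exact_mod_cast h2) this
  · exact h2

/-- the quadratic form inside the bubble -/
def Qf (m : ℕ) (y : EuclideanSpace ℝ (Fin (m + 1))) : ℝ :=
  (1 + y (Fin.last m)) ^ 2 + ∑ i : Fin m, y i.castSucc ^ 2

lemma bubble_eq (m : ℕ) [NeZero (m + 1)] :
    bubble (m + 1) = fun y => Qf m y ^ (-((m : ℝ) - 1) / 2) := by
  funext y
  have h1 : lastIdx (m + 1) = Fin.last m := rfl
  have h2 : barNormSq (m + 1) y = ∑ i : Fin m, y i.castSucc ^ 2 := by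
    simp [barNormSq, Fin.sum_univ_castSucc]
  rw [bubble, h2, lastCoord, h1, Qf]
  congr 2
  push_cast
  ring

/-- derivative of `Qf` -/
def Qd (m : ℕ) (y : EuclideanSpace ℝ (Fin (m + 1))) : EuclideanSpace ℝ (Fin (m + 1)) →L[ℝ] ℝ :=
  (2 * (1 + y (Fin.last m))) • EuclideanSpace.proj (Fin.last m) +
    ∑ i : Fin m, (2 * y i.castSucc) • EuclideanSpace.proj i.castSucc

lemma hasFDerivAt_coord (m : ℕ) (y : EuclideanSpace ℝ (Fin (m + 1))) (c : Fin (m + 1)) :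
    HasFDerivAt (fun y : EuclideanSpace ℝ (Fin (m + 1)) => y c)
      (EuclideanSpace.proj c : EuclideanSpace ℝ (Fin (m + 1)) →L[ℝ] ℝ) y :=
  (EuclideanSpace.proj c : EuclideanSpace ℝ (Fin (m + 1)) →L[ℝ] ℝ).hasFDerivAt

lemma hasFDerivAt_Qf (m : ℕ) (y : EuclideanSpace ℝ (Fin (m + 1))) :
    HasFDerivAt (Qf m) (Qd m y) y := by
  unfold Qf Qd
  refine HasFDerivAt.add ?_ (HasFDerivAt.fun_sum fun i _ => ?_)
  · have := ((hasFDerivAt_coord m y (Fin.last m)).const_add 1).pow 2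
    simpa [mul_add] using this
  · have := (hasFDerivAt_coord m y i.castSucc).pow 2
    simpa using this

lemma Qd_castSucc (m : ℕ) (y : EuclideanSpace ℝ (Fin (m + 1))) (i : Fin m) :
    Qd m y (EuclideanSpace.single i.castSucc 1) = 2 * y i.castSucc := by
  have h : Fin.last m ≠ i.castSucc := (Fin.castSucc_lt_last i).ne'
  simp [Qd, h]

lemma Qd_last (m : ℕ) (y : EuclideanSpace ℝ (Fin (m + 1))) :
    Qd m y (EuclideanSpace.single (Fin.last m) 1) = 2 * (1 + y (Fin.last m)) := by
  have h : ∀ i : Fin m, i.castSucc ≠ Fin.last m := fun i => (Fin.castSucc_lt_last i).ne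
  simp [Qd, h]

lemma pd_bubble (m : ℕ) [NeZero (m + 1)] (y : EuclideanSpace ℝ (Fin (m + 1)))
    (hy : 0 < Qf m y) (c : Fin (m + 1)) :
    partialDeriv (m + 1) (bubble (m + 1)) c y =
      (-((m : ℝ) - 1) / 2) * Qf m y ^ (-((m : ℝ) - 1) / 2 - 1) *
        Qd m y (EuclideanSpace.single c 1) := by
  rw [partialDeriv, bubble_eq, ((hasFDerivAt_Qf m y).rpow_const (Or.inl hy.ne')).fderiv]
  simp

lemma pd2_bubble (m : ℕ) [NeZero (m + 1)] (y : EuclideanSpace ℝ (Fin (m + 1)))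
    (hy : 0 < Qf m y) (i j : Fin m) :
    partialDeriv (m + 1) (partialDeriv (m + 1) (bubble (m + 1)) i.castSucc) j.castSucc y =
      (-((m : ℝ) - 1)) * ((-((m : ℝ) - 1) / 2 - 1) * Qf m y ^ (-((m : ℝ) - 1) / 2 - 1 - 1) * 2 *
        (y i.castSucc * y j.castSucc) +
        if i = j then Qf m y ^ (-((m : ℝ) - 1) / 2 - 1) else 0) := by
  have hcont : ContinuousAt (Qf m) y := (hasFDerivAt_Qf m y).continuousAt
  have hev : partialDeriv (m + 1) (bubble (m + 1)) i.castSucc =ᶠ[nhds y]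
      fun z => (-((m : ℝ) - 1)) * (Qf m z ^ (-((m : ℝ) - 1) / 2 - 1) * z i.castSucc) := by
    filter_upwards [hcont.eventually (lt_mem_nhds hy)] with z hz
    rw [pd_bubble m z hz, Qd_castSucc]
    ring
  have hd := ((((hasFDerivAt_Qf m y).rpow_const (p := -((m : ℝ) - 1) / 2 - 1)
    (Or.inl hy.ne')).fun_mul (hasFDerivAt_coord m y i.castSucc)).const_mul (-((m : ℝ) - 1)))
  rw [partialDeriv, hev.fderiv_eq, HasFDerivAt.fderiv hd]
  simp only [smul_apply, add_apply, Qd_castSucc, smul_eq_mul]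
  congr 1
  by_cases hij : i = j
  · subst hij
    simp
    ring
  · have : i.castSucc ≠ j.castSucc := fun h => hij (Fin.castSucc_injective m h)
    simp [hij, this]
    ring

lemma sum_antisymm (m : ℕ) (A H : Fin m → Fin m → ℝ) (hA : ∀ i j, A i j = - A j i)
    (hH : ∀ i j, H i j = H j i) : ∑ i, ∑ j, A i j * H i j = 0 := by
  have h1 : ∑ i, ∑ j, A i j * H i j = ∑ i, ∑ j, - (A i j * H i j) := by
    rw [Finset.sum_comm]
    refine Finset.sum_congr rfl fun i _ => Finset.sum_congr rfl fun j _ => ?_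
    rw [hA, hH]; ring
  simp only [Finset.sum_neg_distrib] at h1
  linarith

lemma F_eq (m : ℕ) [NeZero (m + 1)] (y : EuclideanSpace ℝ (Fin (m + 1)))
    (hy : 0 < Qf m y)
    (a : Fin m → Fin m → Fin m → Fin m → ℝ)
    (b : Fin m → Fin m → ℝ)
    (ha : ∀ i j k l, a i j k l = -a j i k l)
    (hb : ∑ i : Fin m, b i i = 0) :
    (∑ i : Fin m, ∑ j : Fin m,
            ((1 / 3) * (∑ k : Fin m, ∑ l : Fin m,
                a i j k l * y k.castSucc * y l.castSucc)
              + b i j * (y (Fin.last m)) ^ 2)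
            * partialDeriv (m + 1) (partialDeriv (m + 1) (bubble (m + 1)) i.castSucc)
              j.castSucc y) =
    (∑ i, ∑ j, b i j * (y (Fin.castSucc i) * y (Fin.castSucc j))) *
      (y (Fin.last m) ^ 2 * (-((m : ℝ) - 1)) * ((-((m : ℝ) - 1) / 2 - 1) *
        Qf m y ^ (-((m : ℝ) - 1) / 2 - 1 - 1) * 2)) := by
  simp only [pd2_bubble m y hy, add_mul _ _ (_ * _), Finset.sum_add_distrib]
  rw [sum_antisymm, zero_add]
  · simp only [mul_add, mul_ite, mul_zero, Finset.sum_add_distrib, Finset.sum_ite_eq,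
      Finset.mem_univ, if_true]
    rw [← Finset.sum_mul, ← Finset.sum_mul, hb]
    simp only [zero_mul, add_zero, Finset.sum_mul]
    refine Finset.sum_congr rfl fun i _ => Finset.sum_congr rfl fun j _ => ?_
    ring
  · intro i j
    rw [← mul_neg, ← Finset.sum_neg_distrib]
    congr 1
    refine Finset.sum_congr rfl fun k _ => ?_
    rw [← Finset.sum_neg_distrib]
    refine Finset.sum_congr rfl fun l _ => ?_
    rw [ha]; ring
  · intro i j
    rw [mul_comm (y i.castSucc)]
    simp only [eq_comm]

lemma Qf_pos (m : ℕ) (y : EuclideanSpace ℝ (Fin (m + 1))) (hy : 0 ≤ y (Fin.last m)) :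
    0 < Qf m y := by
  unfold Qf
  positivity

/-- If `a_{ijkl}` is antisymmetric in its first two indices and `b_{ij}` is trace-free,
then `F(y) := ∑_{i,j} [(1/3)∑_{k,l} a_{ijkl} y_k y_l + b_{ij} yₙ²] ∂²_{ij}U(y)` is
`L²(ℝⁿ₊)`-orthogonal to `U` and to `∑_b y_b ∂_b U`. -/
theorem statement19 (n : ℕ) [NeZero n] (hn : 5 ≤ n)
    (a : Fin (n - 1) → Fin (n - 1) → Fin (n - 1) → Fin (n - 1) → ℝ)
    (b : Fin (n - 1) → Fin (n - 1) → ℝ)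
    (ha : ∀ i j k l, a i j k l = -a j i k l)
    (hb : ∑ i : Fin (n - 1), b i i = 0) :
    (∫ y in halfSpace n,
        (∑ i : Fin (n - 1), ∑ j : Fin (n - 1),
            ((1 / 3) * (∑ k : Fin (n - 1), ∑ l : Fin (n - 1),
                a i j k l * y (bIdx n k) * y (bIdx n l))
              + b i j * (lastCoord n y) ^ 2)
            * partialDeriv n (partialDeriv n (bubble n) (bIdx n i)) (bIdx n j) y)
          * bubble n y = 0) ∧
    (∫ y in halfSpace n,
        (∑ i : Fin (n - 1), ∑ j : Fin (n - 1),
            ((1 / 3) * (∑ k : Fin (n - 1), ∑ l : Fin (n - 1),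
                a i j k l * y (bIdx n k) * y (bIdx n l))
              + b i j * (lastCoord n y) ^ 2)
            * partialDeriv n (partialDeriv n (bubble n) (bIdx n i)) (bIdx n j) y)
          * (∑ c : Fin n, y c * partialDeriv n (bubble n) c y) = 0) := by
  obtain ⟨m, rfl⟩ : ∃ m, n = m + 1 := ⟨n - 1, by omega⟩
  have : NeZero m := ⟨by omega⟩
  have hmeas : MeasurableSet (halfSpace (m + 1)) := by
    have : halfSpace (m + 1) =
        (fun y : EuclideanSpace ℝ (Fin (m + 1)) => y (Fin.last m)) ⁻¹' Set.Ici 0 := rfl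
    rw [this]
    exact (EuclideanSpace.proj (Fin.last m) : EuclideanSpace ℝ (Fin (m + 1)) →L[ℝ] ℝ).measurable
      measurableSet_Ici
  constructor
  · rw [← core_zero m b hb (fun r t => (t ^ 2 * (-((m : ℝ) - 1)) * ((-((m : ℝ) - 1) / 2 - 1) *
        ((1 + t) ^ 2 + r) ^ (-((m : ℝ) - 1) / 2 - 1 - 1) * 2)) *
        ((1 + t) ^ 2 + r) ^ (-((m : ℝ) - 1) / 2))]
    refine setIntegral_congr_fun hmeas fun y hy => ?_
    have hQ := Qf_pos m y hy
    refine (congrArg (· * bubble (m + 1) y) (F_eq m y hQ a b ha hb)).trans ?_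
    simp only [bubble_eq, Qf]
    ring
  · rw [← core_zero m b hb (fun r t => (t ^ 2 * (-((m : ℝ) - 1)) * ((-((m : ℝ) - 1) / 2 - 1) *
        ((1 + t) ^ 2 + r) ^ (-((m : ℝ) - 1) / 2 - 1 - 1) * 2)) *
        ((-((m : ℝ) - 1)) * ((1 + t) ^ 2 + r) ^ (-((m : ℝ) - 1) / 2 - 1) *
          (r + t * (1 + t))))]
    refine setIntegral_congr_fun hmeas fun y hy => ?_
    have hQ := Qf_pos m y hy
    have hE : ∑ c : Fin (m + 1), y c * partialDeriv (m + 1) (bubble (m + 1)) c y =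
        (-((m : ℝ) - 1)) * Qf m y ^ (-((m : ℝ) - 1) / 2 - 1) *
          (∑ i : Fin m, y i.castSucc ^ 2 + y (Fin.last m) * (1 + y (Fin.last m))) := by
      simp only [pd_bubble m y hQ, Fin.sum_univ_castSucc, Qd_castSucc, Qd_last]
      rw [mul_add (_ * _), Finset.mul_sum]
      congr 1
      · refine Finset.sum_congr rfl fun i _ => ?_
        ring
      · ring
    refine (congrArg₂ (· * ·) (F_eq m y hQ a b ha hb) hE).trans ?_
    simp only [Qf]
    ring
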